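/- arXiv:2604.27501 — 2 statements merged into one kernel-verified Lean document; each statement's English description precedes it below -/
import Mathlib

section
/- Let F_q be a finite field of odd characteristic with q elements. There exists an absolute constant C > 0 such that every subset A ⊆ F_q with |A| ≥ C·q^{5/6} contains a nontrivial quadratic progression; that is, there exist x ∈ F_q and y ∈ F_q with y ≠ 0 such that x ∈ A, x + y ∈ A, and x + y² ∈ A. -/
section Stepanov

open Polynomial Finset

variable {L : Type*} [Field L]

/-- The additive trace polynomial `x + x^q + ⋯ + x^(q^(n-1))`. -/
def frobeniusSum (q n : ℕ) (x : L) : L := ∑ i ∈ range n, x ^ q ^ i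

lemma natDegree_sum_pow_pow {f : L[X]} {q : ℕ} (hq : 2 ≤ q) (hf : 0 < f.natDegree) (k : ℕ) :
    (∑ i ∈ range (k + 1), f ^ q ^ i).natDegree = q ^ k * f.natDegree := by
  induction k with
  | zero => simp
  | succ k ih =>
    rw [sum_range_succ, natDegree_add_eq_right_of_natDegree_lt, natDegree_pow]
    rw [ih, natDegree_pow]
    exact Nat.mul_lt_mul_of_pos_right (Nat.pow_lt_pow_right (by omega) (by omega)) hf

/-- Exponents `m + q A i + j A d` with `m < A`, `j < q` determine `m`, `i`, `j` if `d` and `q` are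
coprime. -/
lemma exponent_injective {A q d m m' i i' j j' : ℕ} (hd : d.Coprime q) (hm : m < A) (hm' : m' < A)
    (hj : j < q) (hj' : j' < q)
    (h : m + q * A * i + j * (A * d) = m' + q * A * i' + j' * (A * d)) :
    m = m' ∧ i = i' ∧ j = j' := by
  have h' : m + A * (q * i + j * d) = m' + A * (q * i' + j' * d) := by linarith
  have h1 : m = m' := by
    have := congrArg (· % A) h'
    simpa [Nat.mod_eq_of_lt hm, Nat.mod_eq_of_lt hm'] using this
  subst h1
  have h2 : q * i + j * d = q * i' + j' * d :=
    Nat.eq_of_mul_eq_mul_left (by omega) (Nat.add_left_cancel h')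
  have h3 : j = j' := by
    have h4 : j * d ≡ j' * d [MOD q] := by
      have := congrArg (· % q) h2
      simpa [Nat.ModEq] using this
    have h5 := Nat.ModEq.cancel_right_of_coprime (Nat.coprime_comm.mp hd) h4
    simpa [Nat.ModEq, Nat.mod_eq_of_lt hj, Nat.mod_eq_of_lt hj'] using h5
  subst h3
  exact ⟨rfl, Nat.eq_of_mul_eq_mul_left (by omega) (Nat.add_right_cancel h2), rfl⟩

lemma sum_pow_prime_pow_pow {p e q : ℕ} [Fact p.Prime] [CharP L p] (hq : q = p ^ e) {ι : Type*}
    (s : Finset ι) (g : ι → L) (k : ℕ) : (∑ i ∈ s, g i) ^ q ^ k = ∑ i ∈ s, g i ^ q ^ k := by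
  have : ExpChar L p := ExpChar.prime Fact.out
  rw [hq, ← pow_mul, sum_pow_char_pow]

/-- Stepanov's bound for the fibres of `y ↦ Tr (f y)`. -/
theorem card_frobeniusSum_fiber_le [Fintype L] [DecidableEq L] {p e k : ℕ} [Fact p.Prime]
    [CharP L p] (he : 0 < e) (hcard : Fintype.card L = ((p ^ e) ^ (k + 1)) ^ 2) {f : L[X]}
    (hf : f.natDegree.Coprime (p ^ e)) (b : L) :
    #{y : L | frobeniusSum (p ^ e) (2 * (k + 1)) (f.eval y) = b}
      ≤ ((p ^ e) ^ k + 2 * f.natDegree) * (p ^ e) ^ (k + 1) := by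
  set q := p ^ e with hq
  have hq2 : 2 ≤ q := le_trans (Fact.out : p.Prime).two_le (Nat.le_self_pow he.ne' p)
  set d := f.natDegree with hd
  have hd0 : 0 < d := by
    rcases Nat.eq_zero_or_pos d with h | h
    · rw [h, Nat.coprime_zero_left] at hf; omega
    · exact h
  set A := q ^ k with hA
  have hA0 : 0 < A := by positivity
  have hR : q ^ (k + 1) = q * A := by rw [pow_succ, mul_comm]
  set w : L[X] := ∑ i ∈ range (k + 1), f ^ q ^ i with hw
  have hwd : w.natDegree = A * d := natDegree_sum_pow_pow hq2 hd0 k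
  have hw0 : w ≠ 0 := by
    rintro h
    rw [h, natDegree_zero] at hwd
    have : 0 < A * d := by positivity
    omega
  set N := q * A * (A - 1) + (A + d) + (q - 1) * (A * d) with hN
  let v : Fin A × Fin (A + d) × Fin q → L[X] := fun t =>
    X ^ (q * A * t.1 + t.2.1) * (C b - w) ^ (t.2.2 : ℕ)
  have hv : ∀ t, v t ∈ degreeLT L N := by
    intro t
    rw [mem_degreeLT]
    refine lt_of_le_of_lt degree_le_natDegree (Nat.cast_lt.mpr ?_)
    refine lt_of_le_of_lt natDegree_mul_le ?_
    rw [natDegree_X_pow]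
    have h1 : ((C b - w) ^ (t.2.2 : ℕ)).natDegree ≤ (q - 1) * (A * d) := by
      refine natDegree_pow_le.trans (Nat.mul_le_mul (by omega) ?_)
      refine (natDegree_sub_le _ _).trans ?_
      simp [hwd]
    have h2 : q * A * (t.1 : ℕ) ≤ q * A * (A - 1) := Nat.mul_le_mul_left _ (by omega)
    have := t.2.1.2
    omega
  have hdep : ¬ LinearIndependent L (fun t => (⟨v t, hv t⟩ : degreeLT L N)) := by
    intro h
    have h1 := h.fintype_card_le_finrank
    have h2 : Module.finrank L (degreeLT L N) = N := by
      rw [(degreeLTEquiv L N).finrank_eq]; simp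
    rw [h2] at h1
    simp only [Fintype.card_prod, Fintype.card_fin] at h1
    obtain ⟨A', hA'⟩ : ∃ A', A = A' + 1 := ⟨A - 1, by omega⟩
    obtain ⟨q', hq'⟩ : ∃ q', q = q' + 2 := ⟨q - 2, by omega⟩
    rw [hN, hA', hq'] at h1
    simp only [Nat.add_sub_cancel, show q' + 2 - 1 = q' + 1 by omega] at h1
    nlinarith [Nat.zero_le (A' * d), Nat.zero_le (A' * q'), Nat.zero_le d]
  rw [Fintype.not_linearIndependent_iff] at hdep
  obtain ⟨c, hc, t₀, ht₀⟩ := hdep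
  have hc' : ∑ t, c t • v t = 0 := by
    have := congrArg Subtype.val hc
    simpa using this
  let u : Fin A × Fin (A + d) × Fin q → L[X] := fun t =>
    C (c t ^ (q * A)) * (X ^ (t.1 + q * A * t.2.1 : ℕ) * w ^ (t.2.2 : ℕ))
  have hqA : q * A ≠ 0 := by positivity
  have hu0 : ∀ t, u t ≠ 0 → c t ≠ 0 := by
    rintro t ht h
    apply ht
    simp [u, h, hqA]
  have hudeg : ∀ t, c t ≠ 0 →
      (u t).degree = ((t.1 + q * A * t.2.1 + t.2.2 * (A * d) : ℕ) : WithBot ℕ) := by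
    intro t ht
    have : u t ≠ 0 := by
      simp only [u]
      refine mul_ne_zero (by simp [ht]) (mul_ne_zero (by simp) (pow_ne_zero _ hw0))
    rw [degree_eq_natDegree this]
    simp only [u]
    rw [natDegree_C_mul (pow_ne_zero _ ht), natDegree_mul (by simp) (pow_ne_zero _ hw0),
      natDegree_X_pow, natDegree_pow, hwd]
  set H : L[X] := ∑ t, u t with hH
  have hHdeg : H.degree = univ.sup fun t => (u t).degree := by
    apply degree_sum_eq_of_disjoint
    rintro t ⟨-, ht⟩ t' ⟨-, ht'⟩ htt'
    simp only [Function.onFun, Function.comp]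
    rw [hudeg t (hu0 t ht), hudeg t' (hu0 t' ht')]
    intro h
    obtain ⟨h1, h2, h3⟩ := exponent_injective hf t.1.2 t'.1.2 t.2.2.2 t'.2.2.2 (Nat.cast_inj.mp h)
    exact htt' (Prod.ext (Fin.ext h1) (Prod.ext (Fin.ext h2) (Fin.ext h3)))
  have hH0 : H ≠ 0 := by
    intro h
    have h1 : (u t₀).degree ≤ H.degree := by
      rw [hHdeg]; exact Finset.le_sup (f := fun t => (u t).degree) (mem_univ t₀)
    rw [h, hudeg t₀ ht₀, degree_zero, le_bot_iff] at h1
    exact WithBot.coe_ne_bot h1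
  have hHle : H.natDegree ≤ (A + 2 * d) * (q * A) := by
    rw [natDegree_le_iff_degree_le, hHdeg]
    refine Finset.sup_le fun t _ => ?_
    by_cases ht : c t = 0
    · simp [u, ht, hqA]
    rw [hudeg t ht, Nat.cast_le]
    have h1 : (t.1 : ℕ) + 1 ≤ A := t.1.2
    have h2 : (t.2.1 : ℕ) + 1 ≤ A + d := t.2.1.2
    have h3 : (t.2.2 : ℕ) + 1 ≤ q := t.2.2.2
    have h4 := Nat.mul_le_mul_left (q * A) h2
    have h5 := Nat.mul_le_mul_right (A * d) h3
    have h6 : A ≤ q * A := Nat.le_mul_of_pos_left _ (by omega)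
    nlinarith
  have hroot : ∀ y : L, frobeniusSum q (2 * (k + 1)) (f.eval y) = b → H.eval y = 0 := by
    intro y hy
    have hyQ : (y ^ (q * A)) ^ (q * A) = y := by
      rw [← pow_mul, ← hR, ← pow_two, ← hcard, FiniteField.pow_card]
    have hymul : ∀ i, (y ^ (q * A)) ^ (q * A * i) = y ^ i := fun i => by rw [pow_mul, hyQ]
    have hcQ : ∀ t, (c t ^ (q * A)) ^ (q * A) = c t := fun t => by
      rw [← pow_mul, ← hR, ← pow_two, ← hcard, FiniteField.pow_card]
    have hwy : w.eval y = frobeniusSum q (k + 1) (f.eval y) := by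
      simp [hw, frobeniusSum, eval_finsetSum]
    have hwR : (w.eval y) ^ (q * A) = b - w.eval y := by
      rw [eq_sub_iff_add_eq, ← hy, hwy, ← hR]
      simp only [frobeniusSum]
      rw [sum_pow_prime_pow_pow hq, two_mul,
        sum_range_add (fun i => f.eval y ^ q ^ i) (k + 1) (k + 1), add_comm]
      congr 1
      refine sum_congr rfl fun i _ => ?_
      rw [← pow_mul, ← pow_add, add_comm]
    have hpow : (H.eval y) ^ (q * A) = (∑ t, c t • v t).eval y := by
      rw [hH, eval_finsetSum, eval_finsetSum, ← hR, sum_pow_prime_pow_pow hq, hR]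
      refine sum_congr rfl fun t _ => ?_
      simp only [u, v, eval_mul, eval_C, eval_pow, eval_X, eval_smul, smul_eq_mul, eval_sub]
      rw [mul_pow, hcQ, mul_pow, pow_right_comm (w.eval y), hwR, pow_right_comm y, pow_add, hymul,
        pow_add, pow_mul y (q * A) (t.1 : ℕ)]
    rw [hc', eval_zero] at hpow
    exact pow_eq_zero_iff hqA |>.mp hpow
  calc #{y : L | frobeniusSum q (2 * (k + 1)) (f.eval y) = b}
      ≤ H.roots.toFinset.card := by
        refine card_le_card fun y hy => ?_
        simp only [mem_filter, mem_univ, true_and] at hy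
        simpa [hH0] using hroot y hy
    _ ≤ H.natDegree := (Multiset.toFinset_card_le _).trans (card_roots' H)
    _ ≤ _ := by rw [hR]; exact hHle

lemma frobeniusSum_sub {p e q : ℕ} [Fact p.Prime] [CharP L p] (hq : q = p ^ e) (n : ℕ)
    (x y : L) : frobeniusSum q n (x - y) = frobeniusSum q n x - frobeniusSum q n y := by
  have : ExpChar L p := ExpChar.prime Fact.out
  simp only [frobeniusSum, ← sum_sub_distrib, hq, ← pow_mul, sub_pow_expChar_pow]

lemma frobeniusSum_pow [Fintype L] {p e q n : ℕ} [Fact p.Prime] [CharP L p] (hq : q = p ^ e)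
    (hcard : Fintype.card L = q ^ n) (x : L) : frobeniusSum q n x ^ q = frobeniusSum q n x := by
  have h := sum_pow_prime_pow_pow hq (range n) (fun i => x ^ q ^ i) 1
  rw [pow_one] at h
  simp only [frobeniusSum]
  rw [h]
  simp only [← pow_mul, ← pow_succ]
  rw [← sub_eq_zero, ← sum_sub_distrib, sum_range_sub (fun i => x ^ q ^ i), ← hcard,
    FiniteField.pow_card]
  simp

/-- Weil's bound for `∑ ψ (f y)`, when `ψ` factors through the trace to the field of order `q`. -/
theorem norm_sum_addChar_eval_le [Fintype L] {p e k : ℕ} [Fact p.Prime]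
    [CharP L p] (he : 0 < e) (hcard : Fintype.card L = ((p ^ e) ^ (k + 1)) ^ 2) {ψ : AddChar L ℂ}
    (hψ1 : ψ ≠ 1) (hψ : ∀ x, frobeniusSum (p ^ e) (2 * (k + 1)) x = 0 → ψ x = 1) {f : L[X]}
    (hf : f.natDegree.Coprime (p ^ e)) :
    ‖∑ y, ψ (f.eval y)‖ ≤ 2 * f.natDegree * (p ^ e : ℕ) * ((p ^ e) ^ (k + 1) : ℕ) := by
  classical
  have hst := card_frobeniusSum_fiber_le he hcard hf
  obtain ⟨q, hq⟩ : ∃ q, q = p ^ e := ⟨_, rfl⟩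
  rw [← hq] at hcard hψ hst ⊢
  have hq2 : 2 ≤ q := hq ▸ le_trans (Fact.out : p.Prime).two_le (Nat.le_self_pow he.ne' p)
  have hcard' : Fintype.card L = q ^ (2 * (k + 1)) := by rw [hcard, ← pow_mul, mul_comm]
  set T := frobeniusSum q (2 * (k + 1)) (L := L) with hT
  set κ := #{x : L | T x = 0} with hκ
  set d := f.natDegree
  have hfib : ∀ x₀, #{x : L | T x = T x₀} = κ := by
    intro x₀
    refine card_bij (fun x _ => x - x₀) ?_ ?_ ?_
    · intro x hx
      simpa [T, frobeniusSum_sub hq, sub_eq_zero] using hx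
    · intro a _ b _ h
      simpa using h
    · intro b hb
      refine ⟨b + x₀, ?_, by simp⟩
      have := frobeniusSum_sub hq (2 * (k + 1)) (b + x₀) x₀
      simp only [add_sub_cancel_right] at this
      simp only [mem_filter, mem_univ, true_and, T] at hb ⊢
      rw [hb] at this
      exact (sub_eq_zero.mp this.symm)
  have hκ0 : 0 < κ := by
    rw [← hfib 0]
    exact card_pos.mpr ⟨0, by simp⟩
  have himage : #(univ.image T) ≤ q := by
    have hP : (X ^ q - X : L[X]) ≠ 0 := FiniteField.X_pow_card_sub_X_ne_zero L (by omega)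
    calc #(univ.image T) ≤ (X ^ q - X : L[X]).roots.toFinset.card := by
          refine card_le_card fun b hb => ?_
          obtain ⟨x, -, rfl⟩ := mem_image.mp hb
          simp [hP, T, frobeniusSum_pow hq hcard' x]
      _ ≤ (X ^ q - X : L[X]).natDegree := (Multiset.toFinset_card_le _).trans (card_roots' _)
      _ = q := FiniteField.X_pow_card_sub_X_natDegree_eq L (by omega)
  have hQκ : Fintype.card L ≤ κ * q := by
    calc Fintype.card L = #(univ : Finset L) := rfl
      _ ≤ κ * #(univ.image T) := by
          refine card_le_mul_card_image _ _ fun b hb => ?_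
          obtain ⟨x, -, rfl⟩ := mem_image.mp hb
          exact (hfib x).le
      _ ≤ κ * q := Nat.mul_le_mul_left _ himage
  set S := ∑ y, ψ (f.eval y) with hS
  set Z : L → ℕ := fun b => #{y : L | T (f.eval y) = b} with hZ
  set c : ℝ := (((q ^ k + 2 * d) * q ^ (k + 1) : ℕ) : ℝ) with hc
  have hsumψ : ∀ y, ∑ x, ψ x * (if T (f.eval y) = T x then 1 else 0) = κ * ψ (f.eval y) := by
    intro y
    simp only [mul_ite, mul_one, mul_zero]
    rw [← sum_filter, ← hfib (f.eval y), ← nsmul_eq_mul, ← sum_const]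
    rw [filter_congr (q := fun x => T x = T (f.eval y)) (fun _ _ => eq_comm)]
    refine sum_congr rfl fun x hx => ?_
    have hx' : T x = T (f.eval y) := by simpa using hx
    have h1 : ψ (x - f.eval y) = 1 := hψ _ (by
      have := frobeniusSum_sub hq (2 * (k + 1)) x (f.eval y)
      exact this.trans (sub_eq_zero.mpr hx'))
    rw [← sub_add_cancel x (f.eval y), AddChar.map_add_eq_mul, h1, one_mul]
  have hid : ∑ x, ψ x * ((c - Z (T x) : ℝ) : ℂ) = - (κ * S) := by
    push_cast
    simp only [mul_sub, sum_sub_distrib, ← sum_mul]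
    rw [AddChar.sum_eq_zero_iff_ne_zero.mpr hψ1, zero_mul, zero_sub, hS, mul_sum]
    congr 1
    simp only [← hsumψ, Z, card_filter, Nat.cast_sum, mul_sum]
    rw [sum_comm]
    simp
  have hle : ∀ x, (Z (T x) : ℝ) ≤ c := fun x => by
    simpa [Z, c] using (Nat.cast_le (α := ℝ)).mpr (hst (T x))
  have hZsum : ∑ x, (Z (T x) : ℝ) = κ * Fintype.card L := by
    simp only [Z, card_filter, Nat.cast_sum]
    rw [sum_comm]
    have : ∀ y, ∑ x, (((if T (f.eval y) = T x then 1 else 0 : ℕ)) : ℝ) = κ := by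
      intro y
      rw [← hfib (f.eval y), card_filter, Nat.cast_sum]
      refine sum_congr rfl fun x _ => ?_
      simp only [eq_comm]
    simp only [this, sum_const, card_univ, nsmul_eq_mul, mul_comm]
  have hbound : κ * ‖S‖ ≤ Fintype.card L * (c - κ) := by
    calc κ * ‖S‖ = ‖∑ x, ψ x * ((c - Z (T x) : ℝ) : ℂ)‖ := by rw [hid, norm_neg, norm_mul]; simp
      _ ≤ ∑ x, ‖ψ x * ((c - Z (T x) : ℝ) : ℂ)‖ := norm_sum_le _ _
      _ = ∑ x, (c - Z (T x)) := by
          refine sum_congr rfl fun x _ => ?_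
          rw [norm_mul, AddChar.norm_apply, one_mul, Complex.norm_real, Real.norm_eq_abs,
            abs_of_nonneg (sub_nonneg.mpr (hle x))]
      _ = Fintype.card L * (c - κ) := by
          rw [sum_sub_distrib, hZsum]
          simp
          ring
  have hκ0' : (0 : ℝ) < κ := by exact_mod_cast hκ0
  have hQκ' : (Fintype.card L : ℝ) ≤ κ * q := by exact_mod_cast hQκ
  have hc0 : 0 ≤ c := Nat.cast_nonneg _
  have hQc : (q : ℝ) * c = Fintype.card L + 2 * d * q * (q ^ (k + 1) : ℕ) := by
    rw [hc, hcard]; push_cast; ring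
  have h1 : κ * ‖S‖ ≤ κ * (q * c - Fintype.card L) := by nlinarith
  have h2 := le_of_mul_le_mul_left h1 hκ0'
  rw [hQc] at h2
  linarith

end Stepanov

section Gauss

open Finset

variable {L : Type*} [Field L] [Fintype L]

lemma norm_mulChar_le_one (χ : MulChar L ℂ) (s : L) : ‖χ s‖ ≤ 1 := by
  rcases eq_or_ne s 0 with rfl | hs
  · rw [χ.map_zero, norm_zero]; exact zero_le_one
  have h1 : χ s ^ (Fintype.card L - 1) = 1 := by
    rw [← map_pow, FiniteField.pow_card_sub_one_eq_one s hs, map_one]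
  refine (Complex.norm_eq_one_of_pow_eq_one h1 ?_).le
  have := Fintype.one_lt_card (α := L)
  omega

omit [Fintype L] in
lemma mulShift_ne_one {ψ : AddChar L ℂ} (hψ : ψ ≠ 1) {c : L} (hc : c ≠ 0) :
    ψ.mulShift c ≠ 1 :=
  AddChar.IsPrimitive.of_ne_one hψ hc

lemma sum_addChar_mul {ψ : AddChar L ℂ} (hψ : ψ ≠ 1) {c : L} (hc : c ≠ 0) :
    ∑ t, ψ (c * t) = 0 := by
  simpa using AddChar.sum_eq_zero_of_ne_one (mulShift_ne_one hψ hc)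

lemma norm_gaussSum_le {ψ : AddChar L ℂ} (hψ : ψ ≠ 1) (χ : MulChar L ℂ) :
    ‖gaussSum χ ψ‖ ≤ √(Fintype.card L) := by
  rcases eq_or_ne χ 1 with rfl | hχ
  · rw [gaussSum_one_left hψ, norm_neg, norm_one, Real.one_le_sqrt]
    exact_mod_cast Fintype.card_pos
  · apply Real.le_sqrt_of_sq_le
    have h := gaussSum_mul_gaussSum_eq_card hχ (AddChar.IsPrimitive.of_ne_one hψ)
    rw [← star_gaussSum_eq, ← starRingEnd_apply, Complex.mul_conj, Complex.normSq_eq_norm_sq] at h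
    exact (by exact_mod_cast h : ‖gaussSum χ ψ‖ ^ 2 = Fintype.card L).le

/-- Quadratic Gauss sums have square-root size. -/
lemma norm_sum_addChar_quadratic_le (h2 : ringChar L ≠ 2) {ψ : AddChar L ℂ} (hψ : ψ ≠ 1)
    {α : L} (hα : α ≠ 0) (β : L) :
    ‖∑ s, ψ (α * s ^ 2 + β * s)‖ ≤ √(Fintype.card L) := by
  apply Real.le_sqrt_of_sq_le
  have h20 : (2 : L) ≠ 0 := Ring.two_ne_zero h2
  have key : (∑ s, ψ (α * s ^ 2 + β * s)) * (starRingEnd ℂ) (∑ s, ψ (α * s ^ 2 + β * s))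
      = Fintype.card L := by
    classical
    rw [map_sum, sum_mul_sum, sum_comm]
    calc ∑ t, ∑ s, ψ (α * s ^ 2 + β * s) * (starRingEnd ℂ) (ψ (α * t ^ 2 + β * t))
        = ∑ t, ∑ h, ψ (α * h ^ 2 + β * h) * ψ (2 * α * h * t) := by
          refine sum_congr rfl fun t _ => ?_
          refine (Fintype.sum_equiv (Equiv.addRight t) _ _ fun h => ?_).symm
          rw [← AddChar.map_neg_eq_conj, ← AddChar.map_add_eq_mul, ← AddChar.map_add_eq_mul,
            Equiv.coe_addRight]
          ring_nf
      _ = ∑ h, ψ (α * h ^ 2 + β * h) * ∑ t, ψ (2 * α * h * t) := by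
          rw [sum_comm]; simp only [mul_sum]
      _ = ∑ h : L, if h = 0 then (Fintype.card L : ℂ) else 0 := by
          refine sum_congr rfl fun h _ => ?_
          split_ifs with hh
          · simp [hh]
          · rw [sum_addChar_mul hψ (mul_ne_zero (mul_ne_zero h20 hα) hh), mul_zero]
      _ = Fintype.card L := by simp
  rw [Complex.mul_conj, Complex.normSq_eq_norm_sq] at key
  exact (by exact_mod_cast key : _ = (Fintype.card L : ℝ)).le

end Gauss

section MixedSum

open Finset Polynomial

variable {L : Type*} [Field L] [Fintype L]

/-- The mixed character sum `∑ χ(s) ψ(α s² + β s)`. -/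
noncomputable def mixedSum (χ : MulChar L ℂ) (ψ : AddChar L ℂ) (α β : L) : ℂ :=
  ∑ s, χ s * ψ (α * s ^ 2 + β * s)

/-- `L` has `q ^ n` elements, and the characters `χ` and `ψ ≠ 1` of `L` factor through the norm,
respectively the trace, to the subfield with `q` elements. -/
structure FactorsThroughSubfield (q n : ℕ) (χ : MulChar L ℂ) (ψ : AddChar L ℂ) : Prop where
  card_eq : Fintype.card L = q ^ n
  addChar_ne_one : ψ ≠ 1
  addChar_eq_one : ∀ x, frobeniusSum q n x = 0 → ψ x = 1
  mulChar_eq_one : ∀ y ≠ 0, χ (y ^ (q - 1)) = 1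

theorem norm_mixedSum_le_of_factorsThroughSubfield {p e k : ℕ} [Fact p.Prime] [CharP L p]
    (he : 0 < e) (hp : p ≠ 2) {χ : MulChar L ℂ} {ψ : AddChar L ℂ}
    (h : FactorsThroughSubfield (p ^ e) (2 * (k + 1)) χ ψ) {α : L} (hα : α ≠ 0) (β : L) :
    ‖mixedSum χ ψ α β‖ ≤ 5 * ((p ^ e : ℕ) : ℝ) ^ 2 * √(Fintype.card L) := by
  classical
  have hcard : Fintype.card L = ((p ^ e) ^ (k + 1)) ^ 2 := by
    rw [h.card_eq, ← pow_mul (p ^ e), mul_comm]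
  have hsqrt : √(Fintype.card L) = ((p ^ e) ^ (k + 1) : ℕ) := by
    rw [hcard]; push_cast; exact Real.sqrt_sq (by positivity)
  have hpp : p.Prime := Fact.out
  have hodd : Odd (p ^ e) := (hpp.odd_of_ne_two hp).pow
  have hmix : ∀ f : L[X], f.natDegree.Coprime (p ^ e) → _ :=
    fun f hf => norm_sum_addChar_eval_le he hcard h.addChar_ne_one h.addChar_eq_one hf
  have hχ := h.mulChar_eq_one
  rw [hsqrt]
  obtain ⟨q, hq⟩ : ∃ q, q = p ^ e := ⟨_, rfl⟩
  rw [← hq] at hodd hmix hχ ⊢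
  set R : ℝ := ((q ^ (k + 1) : ℕ) : ℝ) with hR
  have hq2 : 2 ≤ q := hq ▸ le_trans hpp.two_le (Nat.le_self_pow he.ne' p)
  have hqR : (2 : ℝ) ≤ q := by exact_mod_cast hq2
  have hR1 : 1 ≤ R := by rw [hR]; exact_mod_cast Nat.one_le_pow _ _ (by omega)
  have hinner : ∀ s, s ≠ 0 → ‖∑ y ∈ univ.erase (0 : L),
      ψ (α * (s * y ^ (q - 1)) ^ 2 + β * (s * y ^ (q - 1)))‖ ≤ 5 * (q : ℝ) ^ 2 * R := by
    intro s hs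
    set f : L[X] := C (α * s ^ 2) * X ^ (2 * (q - 1)) + C (β * s) * X ^ (q - 1) with hf
    have hdeg : f.natDegree = 2 * (q - 1) := by
      rw [hf, natDegree_add_eq_left_of_natDegree_lt]
      · exact natDegree_C_mul_X_pow _ _ (mul_ne_zero hα (pow_ne_zero _ hs))
      · rw [natDegree_C_mul_X_pow _ _ (mul_ne_zero hα (pow_ne_zero _ hs))]
        exact lt_of_le_of_lt (natDegree_C_mul_X_pow_le (β * s) (q - 1)) (by omega)
    have hcop : f.natDegree.Coprime q := by
      rw [hdeg]
      refine Nat.Coprime.mul_left ?_ ?_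
      · exact (Nat.coprime_two_left).mpr hodd
      · have := (Nat.coprime_self_add_right (m := q - 1) (n := 1)).mpr (Nat.coprime_one_right _)
        rwa [Nat.sub_add_cancel (by omega)] at this
    have heval : ∀ y, f.eval y = α * (s * y ^ (q - 1)) ^ 2 + β * (s * y ^ (q - 1)) := by
      intro y
      simp only [hf, eval_add, eval_mul, eval_C, eval_pow, eval_X]
      ring
    have hb := hmix f hcop
    simp only [heval] at hb
    rw [hdeg, ← add_sum_erase univ _ (mem_univ (0 : L))] at hb
    have h3 := norm_sub_le (ψ (α * (s * 0 ^ (q - 1)) ^ 2 + β * (s * 0 ^ (q - 1)))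
      + ∑ y ∈ univ.erase (0 : L), ψ (α * (s * y ^ (q - 1)) ^ 2 + β * (s * y ^ (q - 1))))
      (ψ (α * (s * 0 ^ (q - 1)) ^ 2 + β * (s * 0 ^ (q - 1))))
    rw [add_sub_cancel_left, AddChar.norm_apply] at h3
    refine h3.trans ((add_le_add_left hb 1).trans ?_)
    push_cast [Nat.cast_sub (show 1 ≤ q by omega)]
    nlinarith [mul_nonneg (by linarith : (0:ℝ) ≤ q) (by linarith : 0 ≤ R)]
  have hshift : ∀ y : L, y ≠ 0 → mixedSum χ ψ α β
      = ∑ s, χ s * ψ (α * (s * y ^ (q - 1)) ^ 2 + β * (s * y ^ (q - 1))) := by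
    intro y hy
    refine (Fintype.sum_bijective _ (mulRight_bijective₀ (y ^ (q - 1)) (pow_ne_zero _ hy)) _ _
      fun s => ?_).symm
    rw [map_mul, hχ y hy, mul_one]
  have havg : (#(univ.erase (0 : L)) : ℂ) * mixedSum χ ψ α β = ∑ s, χ s *
      ∑ y ∈ univ.erase (0 : L), ψ (α * (s * y ^ (q - 1)) ^ 2 + β * (s * y ^ (q - 1))) := by
    rw [← nsmul_eq_mul, ← sum_const, sum_congr rfl fun y hy => hshift y (ne_of_mem_erase hy),
      sum_comm]
    simp only [mul_sum]
  have hpos : (0 : ℝ) < #(univ.erase (0 : L)) := by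
    exact_mod_cast card_pos.mpr ⟨1, by simp⟩
  refine le_of_mul_le_mul_left ?_ hpos
  calc (#(univ.erase (0 : L)) : ℝ) * ‖mixedSum χ ψ α β‖
      = ‖(#(univ.erase (0 : L)) : ℂ) * mixedSum χ ψ α β‖ := by rw [norm_mul]; simp
    _ ≤ ∑ s, ‖χ s * ∑ y ∈ univ.erase (0 : L),
          ψ (α * (s * y ^ (q - 1)) ^ 2 + β * (s * y ^ (q - 1)))‖ := by
        rw [havg]; exact norm_sum_le _ _
    _ = ∑ s ∈ univ.erase (0 : L), ‖χ s * ∑ y ∈ univ.erase (0 : L),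
          ψ (α * (s * y ^ (q - 1)) ^ 2 + β * (s * y ^ (q - 1)))‖ := by
        rw [← add_sum_erase univ _ (mem_univ (0 : L)), χ.map_zero, zero_mul, norm_zero, zero_add]
    _ ≤ ∑ s ∈ univ.erase (0 : L), 5 * (q : ℝ) ^ 2 * R := by
        refine sum_le_sum fun s hs => ?_
        rw [norm_mul]
        refine (mul_le_of_le_one_left (norm_nonneg _) (norm_mulChar_le_one χ s)).trans ?_
        exact hinner s (ne_of_mem_erase hs)
    _ = _ := by rw [sum_const, nsmul_eq_mul]

end MixedSum

section Doubling

open Finset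

variable {L : Type*} [Field L] [Fintype L]

noncomputable instance {ν : L} : Fintype (QuadraticAlgebra L ν 0) :=
  Fintype.ofEquiv _ (QuadraticAlgebra.equivProd ν 0).symm

lemma card_quadraticAlgebra (ν : L) :
    Fintype.card (QuadraticAlgebra L ν 0) = Fintype.card L ^ 2 := by
  rw [Fintype.card_congr (QuadraticAlgebra.equivProd ν 0), Fintype.card_prod, sq]

lemma sum_quadraticAlgebra (ν : L) (f : QuadraticAlgebra L ν 0 → ℂ) :
    ∑ z, f z = ∑ u, ∑ v, f ⟨u, v⟩ := by
  rw [← Fintype.sum_prod_type' fun u v => f ⟨u, v⟩]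
  exact (Fintype.sum_equiv (QuadraticAlgebra.equivProd ν 0).symm _ _ fun _ => rfl).symm

/-- Composition of a multiplicative character with the norm of a quadratic extension. -/
noncomputable def MulChar.liftNorm (ν : L) (χ : MulChar L ℂ) :
    MulChar (QuadraticAlgebra L ν 0) ℂ where
  toMonoidHom := χ.toMonoidHom.comp QuadraticAlgebra.norm
  map_nonunit' _ hz := χ.map_nonunit fun h => hz (QuadraticAlgebra.isUnit_iff_norm_isUnit.mpr h)

/-- Composition of an additive character with the trace of a quadratic extension. -/
noncomputable def AddChar.liftTrace (ν : L) (ψ : AddChar L ℂ) :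
    AddChar (QuadraticAlgebra L ν 0) ℂ :=
  ψ.compAddMonoidHom (QuadraticAlgebra.trace (R := L) (a := ν) (b := 0)).toAddMonoidHom

omit [Fintype L] in
lemma MulChar.liftNorm_apply (ν : L) (χ : MulChar L ℂ) (z : QuadraticAlgebra L ν 0) :
    χ.liftNorm ν z = χ z.norm := rfl

omit [Fintype L] in
lemma AddChar.liftTrace_apply (ν : L) (ψ : AddChar L ℂ) (z : QuadraticAlgebra L ν 0) :
    ψ.liftTrace ν z = ψ (QuadraticAlgebra.trace z) := rfl

/-- Every nonzero element is either a square or `ν` times a square, in two ways. -/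
lemma sum_sq_add_sum_nonsquare_mul_sq (h2 : ringChar L ≠ 2) {ν : L} (hν : ¬ IsSquare ν)
    (f : L → ℂ) : ∑ v, f (v ^ 2) + ∑ v, f (ν * v ^ 2) = 2 * ∑ m, f m := by
  classical
  have hν0 : ν ≠ 0 := by rintro rfl; exact hν IsSquare.zero
  have hsq : ∀ g : L → ℂ, ∑ v, g (v ^ 2) = ∑ m, ((quadraticChar L m + 1 : ℤ) : ℂ) * g m := by
    intro g
    rw [← sum_fiberwise univ (fun v : L => v ^ 2)]
    refine sum_congr rfl fun m _ => ?_
    rw [← quadraticChar_card_sqrts h2, sum_congr rfl fun v hv => by rw [(mem_filter.mp hv).2],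
      sum_const, nsmul_eq_mul]
    congr 2
    simp
  have hην : quadraticChar L ν⁻¹ = -1 := by
    rw [quadraticChar_neg_one_iff_not_isSquare]
    rintro ⟨r, hr⟩
    exact hν ⟨r⁻¹, by rw [← mul_inv, ← hr, inv_inv]⟩
  have hshift : ∑ m, ((quadraticChar L m + 1 : ℤ) : ℂ) * f (ν * m)
      = ∑ m, ((-quadraticChar L m + 1 : ℤ) : ℂ) * f m := by
    refine Fintype.sum_bijective _ (mulLeft_bijective₀ ν hν0) _ _ fun m => ?_
    have : m = ν⁻¹ * (ν * m) := by field_simp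
    conv_lhs => rw [this, map_mul, hην]
    rw [← this, neg_one_mul]
  rw [hsq, hsq (fun x => f (ν * x)), hshift, ← sum_add_distrib, mul_sum]
  refine sum_congr rfl fun m _ => ?_
  push_cast
  ring

omit [Fintype L] in
lemma not_isSquare_of_fact {ν : L} [Fact (∀ r : L, r ^ 2 ≠ ν + 0 * r)] : ¬ IsSquare ν := by
  rintro ⟨r, hr⟩
  exact (Fact.out : ∀ r : L, r ^ 2 ≠ ν + 0 * r) r (by rw [hr]; ring)

omit [Fintype L] in
lemma bijective_add_sub (h2 : ringChar L ≠ 2) :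
    Function.Bijective fun x : L × L => (x.1 + x.2, x.1 - x.2) := by
  have h20 : (2 : L) ≠ 0 := Ring.two_ne_zero h2
  refine ⟨fun x y h => ?_, fun x => ⟨((x.1 + x.2) / 2, (x.1 - x.2) / 2), ?_⟩⟩
  · simp only [Prod.mk.injEq] at h
    ext
    · apply mul_left_cancel₀ h20; linear_combination h.1 + h.2
    · apply mul_left_cancel₀ h20; linear_combination h.1 - h.2
  · ext <;> field_simp <;> ring

theorem mixedSum_lift_add_sq (h2 : ringChar L ≠ 2) {ν : L} [Fact (∀ r : L, r ^ 2 ≠ ν + 0 * r)]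
    (χ : MulChar L ℂ) (ψ : AddChar L ℂ) (α β : L) :
    mixedSum (χ.liftNorm ν) (ψ.liftTrace ν) (algebraMap _ _ α) (algebraMap _ _ β)
      + mixedSum χ ψ α β ^ 2
      = 2 * ((∑ u, ψ (4 * α * u ^ 2 + 2 * β * u)) * ∑ m, χ m * ψ (-2 * α * m)) := by
  set Φ : L → L → ℂ := fun u m => χ (u ^ 2 - m) * ψ (α * (2 * u ^ 2 + 2 * m) + 2 * β * u) with hΦ
  have h1 : mixedSum (χ.liftNorm ν) (ψ.liftTrace ν) (algebraMap _ _ α) (algebraMap _ _ β)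
      = ∑ u, ∑ v, Φ u (ν * v ^ 2) := by
    rw [mixedSum, sum_quadraticAlgebra]
    refine sum_congr rfl fun u _ => sum_congr rfl fun v _ => ?_
    simp only [MulChar.liftNorm_apply, AddChar.liftTrace_apply, QuadraticAlgebra.norm_def,
      QuadraticAlgebra.trace_def, hΦ]
    congr 2
    · ring
    · simp [sq]; ring
  have h3 : mixedSum χ ψ α β ^ 2 = ∑ u, ∑ v, Φ u (v ^ 2) := by
    rw [sq, mixedSum, sum_mul_sum, ← Fintype.sum_prod_type', ← Fintype.sum_prod_type']
    refine (Fintype.sum_bijective _ (bijective_add_sub h2) _ _ fun x => ?_).symm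
    simp only [hΦ]
    rw [mul_mul_mul_comm, ← map_mul, ← AddChar.map_add_eq_mul]
    congr 2 <;> ring
  rw [h1, h3, add_comm, ← sum_add_distrib]
  simp only [sum_sq_add_sum_nonsquare_mul_sq h2 not_isSquare_of_fact]
  rw [← mul_sum, sum_mul_sum]
  congr 1
  refine sum_congr rfl fun u _ => ?_
  refine (Fintype.sum_equiv (Equiv.subLeft (u ^ 2)) _ _ fun m => ?_)
  simp only [hΦ, Equiv.subLeft_apply]
  rw [mul_left_comm, ← AddChar.map_add_eq_mul]
  ring_nf

omit [Fintype L] in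
lemma frobeniusSum_add {p e q : ℕ} [Fact p.Prime] [CharP L p] (hq : q = p ^ e) (n : ℕ)
    (x y : L) : frobeniusSum q n (x + y) = frobeniusSum q n x + frobeniusSum q n y := by
  have : ExpChar L p := ExpChar.prime Fact.out
  simp only [frobeniusSum, ← sum_add_distrib, hq, ← pow_mul, add_pow_expChar_pow]

section Field

variable {ν : L} [Fact (∀ r : L, r ^ 2 ≠ ν + 0 * r)]

omit [Fintype L] in
lemma charP_quadraticAlgebra (p : ℕ) [CharP L p] : CharP (QuadraticAlgebra L ν 0) p :=
  charP_of_injective_algebraMap (algebraMap L (QuadraticAlgebra L ν 0)).injective p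

lemma quadraticAlgebra_pow_card {p e : ℕ} [Fact p.Prime] [CharP L p]
    (hcard : Fintype.card L = p ^ e) (h2 : ringChar L ≠ 2) (z : QuadraticAlgebra L ν 0) :
    z ^ Fintype.card L = star z := by
  have := charP_quadraticAlgebra (ν := ν) p
  have : ExpChar (QuadraticAlgebra L ν 0) p := ExpChar.prime Fact.out
  have hν : ¬ IsSquare ν := not_isSquare_of_fact
  have hν0 : ν ≠ 0 := by rintro rfl; exact hν IsSquare.zero
  have hpow : ν ^ (Fintype.card L / 2) = -1 := by
    exact (FiniteField.pow_dichotomy h2 hν0).resolve_left fun h =>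
      hν ((FiniteField.isSquare_iff h2 hν0).mpr h)
  have hω : (⟨0, 1⟩ : QuadraticAlgebra L ν 0) ^ 2 = algebraMap _ _ ν := by
    ext <;> simp [sq]
  have hωQ : (⟨0, 1⟩ : QuadraticAlgebra L ν 0) ^ Fintype.card L = -⟨0, 1⟩ := by
    have hodd := FiniteField.odd_card_of_char_ne_two h2
    have hhalf : Fintype.card L = 2 * (Fintype.card L / 2) + 1 := by omega
    conv_lhs => rw [hhalf]
    rw [pow_succ, pow_mul, hω, ← map_pow, hpow, map_neg, map_one, neg_one_mul]
  have hz : z = algebraMap _ _ z.re + algebraMap _ _ z.im * ⟨0, 1⟩ := by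
    ext <;> simp
  conv_lhs => rw [hz, hcard, add_pow_expChar_pow, mul_pow, ← hcard, ← map_pow, ← map_pow,
    FiniteField.pow_card, FiniteField.pow_card, hωQ]
  ext <;> simp

theorem FactorsThroughSubfield.lift {p e n : ℕ} [Fact p.Prime] [CharP L p]
    (h2 : ringChar L ≠ 2) {χ : MulChar L ℂ} {ψ : AddChar L ℂ}
    (h : FactorsThroughSubfield (p ^ e) n χ ψ) :
    FactorsThroughSubfield (p ^ e) (2 * n) (χ.liftNorm ν) (ψ.liftTrace ν) where
  card_eq := by rw [card_quadraticAlgebra, h.card_eq, ← pow_mul (p ^ e), mul_comm]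
  addChar_ne_one := by
    obtain ⟨x, hx⟩ := AddChar.ne_one_iff.mp h.addChar_ne_one
    refine AddChar.ne_one_iff.mpr ⟨algebraMap _ _ (x / 2), ?_⟩
    rw [AddChar.liftTrace_apply, QuadraticAlgebra.trace_algebraMap,
      mul_div_cancel₀ _ (Ring.two_ne_zero h2)]
    exact hx
  addChar_eq_one z hz := by
    have := charP_quadraticAlgebra (ν := ν) p
    apply h.addChar_eq_one
    have hcard : Fintype.card L = p ^ (e * n) := by rw [h.card_eq, pow_mul]
    have h3 : frobeniusSum (p ^ e) (2 * n) z
        = algebraMap _ _ (frobeniusSum (p ^ e) n (QuadraticAlgebra.trace z)) := by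
      have h4 : frobeniusSum (p ^ e) (2 * n) z
          = frobeniusSum (p ^ e) n z + frobeniusSum (p ^ e) n (star z) := by
        rw [← quadraticAlgebra_pow_card hcard h2, h.card_eq]
        simp only [frobeniusSum]
        rw [two_mul, sum_range_add (fun i => z ^ (p ^ e) ^ i) n n]
        congr 1
        refine sum_congr rfl fun i _ => ?_
        rw [← pow_mul z, ← pow_add]
      rw [h4, ← frobeniusSum_add rfl, ← QuadraticAlgebra.algebraMap_trace_eq_add_star]
      simp only [frobeniusSum, map_sum, map_pow]
    rw [h3] at hz
    exact (map_eq_zero _).mp hz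
  mulChar_eq_one z hz := by
    rw [MulChar.liftNorm_apply, map_pow]
    exact h.mulChar_eq_one _ (QuadraticAlgebra.norm_eq_zero_iff_eq_zero.not.mpr hz)

end Field

end Doubling

section Weil

open Finset

universe u

/-- Passing to a tower of quadratic extensions amplifies a violation of Weil's bound. -/
lemma exists_large_mixedSum {F : Type u} [Field F] [Fintype F] {p e : ℕ} [Fact p.Prime]
    [CharP F p] (h2 : p ≠ 2) (hcard : Fintype.card F = p ^ e) {ψ : AddChar F ℂ} (hψ : ψ ≠ 1)
    (χ : MulChar F ℂ) {α : F} (hα : α ≠ 0) (β : F) {δ : ℝ} (hδ : 0 ≤ δ)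
    (hlarge : (2 + δ) * √(Fintype.card F) ≤ ‖mixedSum χ ψ α β‖) (k : ℕ) :
    ∃ (L : Type u) (_ : Field L) (_ : Fintype L) (_ : CharP L p) (χ' : MulChar L ℂ)
      (ψ' : AddChar L ℂ) (α' β' : L), FactorsThroughSubfield (p ^ e) (2 ^ k) χ' ψ' ∧ α' ≠ 0 ∧
        (2 + 4 ^ k * δ) * √(Fintype.card L) ≤ ‖mixedSum χ' ψ' α' β'‖ := by
  induction k with
  | zero =>
    refine ⟨F, _, _, ‹_›, χ, ψ, α, β, ⟨by simpa using hcard, hψ, fun x hx => ?_, fun y hy => ?_⟩,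
      hα, by simpa using hlarge⟩
    · have : x = 0 := by simpa [frobeniusSum] using hx
      simp [this]
    · rw [← hcard, FiniteField.pow_card_sub_one_eq_one y hy, map_one]
  | succ k ih =>
    obtain ⟨L, _, _, _, χ', ψ', α', β', hfac, hα', hbig⟩ := ih
    have hchar : ringChar L ≠ 2 := by rwa [ringChar.eq L p] at *
    have h20 : (2 : L) ≠ 0 := Ring.two_ne_zero hchar
    obtain ⟨ν, hν⟩ := FiniteField.exists_nonsquare hchar
    have : Fact (∀ r : L, r ^ 2 ≠ ν + 0 * r) :=
      ⟨fun r hr => hν ⟨r, by rw [← sq, hr, zero_mul, add_zero]⟩⟩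
    refine ⟨QuadraticAlgebra L ν 0, inferInstance, inferInstance, charP_quadraticAlgebra p,
      χ'.liftNorm ν, ψ'.liftTrace ν, algebraMap _ _ α', algebraMap _ _ β', ?_, ?_, ?_⟩
    · rw [pow_succ, mul_comm]
      exact hfac.lift hchar
    · simpa using hα'
    · have hid := mixedSum_lift_add_sq (ν := ν) hchar χ' ψ' α' β'
      have hG1 := norm_sum_addChar_quadratic_le hchar hfac.addChar_ne_one
        (show 4 * α' ≠ 0 from mul_ne_zero (by convert mul_ne_zero h20 h20; norm_num) hα') (2 * β')
      have hG2 := norm_gaussSum_le (mulShift_ne_one hfac.addChar_ne_one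
        (show -2 * α' ≠ 0 from mul_ne_zero (neg_ne_zero.mpr h20) hα')) χ'
      simp only [gaussSum, AddChar.mulShift_apply] at hG2
      set Q : ℝ := (Fintype.card L : ℝ) with hQ
      have hQ0 : 0 ≤ Q := Nat.cast_nonneg _
      have hA : ‖2 * ((∑ u, ψ' (4 * α' * u ^ 2 + 2 * β' * u)) * ∑ m, χ' m * ψ' (-2 * α' * m))‖
          ≤ 2 * Q := by
        rw [norm_mul, norm_mul]
        have := mul_le_mul hG1 hG2 (norm_nonneg _) (Real.sqrt_nonneg _)
        rw [Real.mul_self_sqrt hQ0] at this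
        simpa using this
      have hsq : (2 + 4 ^ k * δ) ^ 2 * Q ≤ ‖mixedSum χ' ψ' α' β'‖ ^ 2 := by
        conv_lhs => rw [← Real.sq_sqrt hQ0, ← mul_pow]
        exact pow_le_pow_left₀ (by positivity) hbig 2
      have hroot : √(Fintype.card (QuadraticAlgebra L ν 0) : ℝ) = Q := by
        rw [card_quadraticAlgebra, Nat.cast_pow, Real.sqrt_sq hQ0]
      rw [hroot]
      have h5 : ‖mixedSum χ' ψ' α' β'‖ ^ 2 - 2 * Q ≤ ‖mixedSum (χ'.liftNorm ν) (ψ'.liftTrace ν)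
          (algebraMap _ _ α') (algebraMap _ _ β')‖ := by
        rw [← norm_pow]
        have := norm_sub_le (2 * ((∑ u, ψ' (4 * α' * u ^ 2 + 2 * β' * u)) *
          ∑ m, χ' m * ψ' (-2 * α' * m))) (mixedSum (χ'.liftNorm ν) (ψ'.liftTrace ν)
          (algebraMap _ _ α') (algebraMap _ _ β'))
        rw [← hid] at this hA
        rw [add_sub_cancel_left] at this
        linarith
      refine le_trans ?_ h5
      have h6 : 0 ≤ (4 ^ k * δ) ^ 2 * Q := by positivity
      rw [pow_succ]
      nlinarith

/-- Weil's bound for `∑ χ(s) ψ(α s² + β s)`. -/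
theorem norm_mixedSum_le {F : Type u} [Field F] [Fintype F] (h2 : ringChar F ≠ 2)
    {ψ : AddChar F ℂ} (hψ : ψ ≠ 1) (χ : MulChar F ℂ) {α : F} (hα : α ≠ 0) (β : F) :
    ‖mixedSum χ ψ α β‖ ≤ 2 * √(Fintype.card F) := by
  obtain ⟨p, hp⟩ := CharP.exists F
  obtain ⟨e, hprime, hcard⟩ := FiniteField.card F p
  have : Fact p.Prime := ⟨hprime⟩
  have hp2 : p ≠ 2 := by rwa [ringChar.eq F p] at h2
  have hroot : 0 < √(Fintype.card F : ℝ) :=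
    Real.sqrt_pos.mpr (Nat.cast_pos.mpr Fintype.card_pos)
  by_contra! hlt
  set δ := ‖mixedSum χ ψ α β‖ / √(Fintype.card F : ℝ) - 2 with hδ
  have hδ0 : 0 < δ := by rw [hδ, sub_pos, lt_div_iff₀ hroot]; exact hlt
  have hlarge : (2 + δ) * √(Fintype.card F) ≤ ‖mixedSum χ ψ α β‖ := by
    rw [hδ, add_sub_cancel, div_mul_cancel₀ _ hroot.ne']
  obtain ⟨k, hk⟩ := pow_unbounded_of_one_lt (5 * ((p ^ (e : ℕ) : ℕ) : ℝ) ^ 2 / δ)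
    (by norm_num : (1 : ℝ) < 4)
  obtain ⟨L, _, _, _, χ', ψ', α', β', hfac, hα', hbig⟩ :=
    exists_large_mixedSum hp2 hcard hψ χ hα β hδ0.le hlarge (k + 1)
  have hexp : 2 ^ (k + 1) = 2 * ((2 ^ k - 1) + 1) := by
    rw [Nat.sub_add_cancel Nat.one_le_two_pow, pow_succ, mul_comm]
  rw [hexp] at hfac
  have hub := norm_mixedSum_le_of_factorsThroughSubfield e.pos hp2 hfac hα' β'
  have hrootL : 0 < √(Fintype.card L : ℝ) :=
    Real.sqrt_pos.mpr (Nat.cast_pos.mpr Fintype.card_pos)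
  have h3 := le_of_mul_le_mul_right (hbig.trans hub) hrootL
  rw [div_lt_iff₀ hδ0] at hk
  rw [pow_succ] at h3
  have : 0 < 4 ^ k * δ := by positivity
  linarith

end Weil

section Fourier

open Finset

variable {G : Type*} [AddCommGroup G] [Fintype G]

/-- The Fourier transform of a real function on a finite abelian group. -/
noncomputable def fourierTransform (u : G → ℝ) (φ : AddChar G ℂ) : ℂ := ∑ g, u g * φ g

lemma sum_apply_mul_fourierTransform (u v : G → ℝ) (w : G) :
    ∑ φ : AddChar G ℂ, φ w * fourierTransform v φ * (starRingEnd ℂ) (fourierTransform u φ)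
      = Fintype.card G * ∑ g, (v g : ℂ) * u (g + w) := by
  classical
  have h1 : ∀ φ : AddChar G ℂ, φ w * fourierTransform v φ * (starRingEnd ℂ) (fourierTransform u φ)
      = ∑ g, ∑ h, (v g : ℂ) * u h * φ (g + w - h) := by
    intro φ
    simp only [fourierTransform, map_sum, map_mul, Complex.conj_ofReal]
    rw [mul_assoc, sum_mul_sum]
    simp only [mul_sum]
    refine sum_congr rfl fun g _ => sum_congr rfl fun h _ => ?_
    rw [← AddChar.map_neg_eq_conj, sub_eq_add_neg, AddChar.map_add_eq_mul, AddChar.map_add_eq_mul]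
    ring
  simp only [h1]
  rw [sum_comm, mul_sum]
  refine sum_congr rfl fun g _ => ?_
  rw [sum_comm]
  simp only [← mul_sum, AddChar.sum_apply_eq_ite, sub_eq_zero]
  rw [sum_congr rfl fun h _ => by rw [mul_ite, mul_zero], sum_ite_eq univ]
  simp
  ring

lemma sum_norm_fourierTransform_sq (u : G → ℝ) :
    ∑ φ : AddChar G ℂ, ‖fourierTransform u φ‖ ^ 2 = Fintype.card G * ∑ g, u g ^ 2 := by
  have h := sum_apply_mul_fourierTransform u u 0
  simp only [AddChar.map_zero_eq_one, one_mul, Complex.mul_conj, Complex.normSq_eq_norm_sq,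
    add_zero, ← sq] at h
  exact_mod_cast h

/-- If all nontrivial character sums over `δ` are small, then `δ` is equidistributed for
correlations. -/
theorem abs_sum_translate_sub_le {ι : Type*} [Fintype ι] {δ : ι → G} {B : ℝ} (hB0 : 0 ≤ B)
    (hB : ∀ φ : AddChar G ℂ, φ ≠ 1 → ‖∑ s, φ (δ s)‖ ≤ B) (u v : G → ℝ) :
    |∑ g, ∑ s, v g * u (g + δ s)
        - Fintype.card ι * ((∑ g, u g) * ∑ g, v g) / Fintype.card G|
      ≤ B * (√(∑ g, u g ^ 2) * √(∑ g, v g ^ 2)) := by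
  classical
  set N : ℝ := (Fintype.card G : ℝ) with hN
  have hN0 : 0 < N := by rw [hN]; exact_mod_cast Fintype.card_pos
  have hall : ∑ φ : AddChar G ℂ, (∑ s, φ (δ s)) * fourierTransform v φ *
      (starRingEnd ℂ) (fourierTransform u φ) = ((N * ∑ g, ∑ s, v g * u (g + δ s) : ℝ) : ℂ) := by
    simp only [sum_mul]
    rw [sum_comm]
    simp only [sum_apply_mul_fourierTransform]
    rw [← mul_sum, sum_comm]
    push_cast [hN]
    rfl
  have htriv : (∑ s, (1 : AddChar G ℂ) (δ s)) * fourierTransform v 1 *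
      (starRingEnd ℂ) (fourierTransform u 1)
      = ((Fintype.card ι * ((∑ g, u g) * ∑ g, v g) : ℝ) : ℂ) := by
    simp only [fourierTransform, AddChar.one_apply, mul_one, map_sum, Complex.conj_ofReal]
    push_cast
    simp
    ring
  have hrest : ‖∑ φ ∈ univ.erase (1 : AddChar G ℂ), (∑ s, φ (δ s)) * fourierTransform v φ *
      (starRingEnd ℂ) (fourierTransform u φ)‖ ≤ B * (N * (√(∑ g, u g ^ 2) * √(∑ g, v g ^ 2))) := by
    calc _ ≤ ∑ φ ∈ univ.erase (1 : AddChar G ℂ), B * (‖fourierTransform u φ‖ *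
            ‖fourierTransform v φ‖) := by
          refine norm_sum_le_of_le _ fun φ hφ => ?_
          rw [norm_mul, norm_mul, RCLike.norm_conj, mul_assoc, mul_comm ‖fourierTransform v φ‖]
          exact mul_le_mul_of_nonneg_right (hB φ (ne_of_mem_erase hφ)) (by positivity)
      _ ≤ ∑ φ : AddChar G ℂ, B * (‖fourierTransform u φ‖ * ‖fourierTransform v φ‖) :=
          sum_le_sum_of_subset_of_nonneg (subset_univ _) fun _ _ _ => by positivity
      _ = B * ∑ φ : AddChar G ℂ, ‖fourierTransform u φ‖ * ‖fourierTransform v φ‖ := by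
          rw [mul_sum]
      _ ≤ B * (√(∑ φ : AddChar G ℂ, ‖fourierTransform u φ‖ ^ 2) *
            √(∑ φ : AddChar G ℂ, ‖fourierTransform v φ‖ ^ 2)) :=
          mul_le_mul_of_nonneg_left (Real.sum_mul_le_sqrt_mul_sqrt _ _ _) hB0
      _ = _ := by
          rw [sum_norm_fourierTransform_sq, sum_norm_fourierTransform_sq, ← hN,
            Real.sqrt_mul hN0.le, Real.sqrt_mul hN0.le, mul_mul_mul_comm,
            Real.mul_self_sqrt hN0.le]
  rw [← add_sum_erase univ _ (mem_univ (1 : AddChar G ℂ)), htriv, ← eq_sub_iff_add_eq',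
    ← Complex.ofReal_sub] at hall
  rw [hall, Complex.norm_real, Real.norm_eq_abs] at hrest
  refine le_of_mul_le_mul_left ?_ hN0
  rw [← abs_of_pos hN0, ← abs_mul, abs_of_pos hN0, mul_sub, mul_div_cancel₀ _ hN0.ne']
  linarith

end Fourier

section Progressions

open Finset

variable {F : Type*} [Field F] [Fintype F]

/-- The number of `y` with `x + y` and `x + y²` in the set with indicator function `f`. -/
def pairCount (f : F → ℝ) (x : F) : ℝ := ∑ y, f (x + y) * f (x + y ^ 2)

lemma abs_sum_pairCount_sub_le (h2 : ringChar F ≠ 2) {f : F → ℝ} (hf : ∀ x, f x = 0 ∨ f x = 1) :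
    |∑ x, pairCount f x - (∑ x, f x) ^ 2| ≤ √(Fintype.card F) * ∑ x, f x := by
  have hsq : ∀ x, f x ^ 2 = f x := fun x => by rcases hf x with h | h <;> simp [h]
  have hf0 : 0 ≤ ∑ x, f x := sum_nonneg fun x _ => by rcases hf x with h | h <;> simp [h]
  have hB : ∀ φ : AddChar F ℂ, φ ≠ 1 → ‖∑ y, φ (y ^ 2 - y)‖ ≤ √(Fintype.card F) := by
    intro φ hφ
    have := norm_sum_addChar_quadratic_le h2 hφ one_ne_zero (-1)
    simpa [← sub_eq_add_neg] using this
  have h := abs_sum_translate_sub_le (Real.sqrt_nonneg _) hB f f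
  have hq : (Fintype.card F : ℝ) ≠ 0 := by exact_mod_cast Fintype.card_ne_zero
  simp only [hsq] at h
  rw [Real.mul_self_sqrt hf0, mul_div_cancel_left₀ _ hq, ← sq] at h
  convert h using 3
  simp only [pairCount]
  rw [sum_comm, sum_comm (s := univ) (t := univ) (f := fun g s => f g * f (g + (s ^ 2 - s)))]
  refine sum_congr rfl fun y _ => Fintype.sum_equiv (Equiv.addRight y) _ _ fun x => ?_
  simp only [Equiv.coe_addRight]
  ring_nf

lemma sum_add_mul_sub (h2 : ringChar F ≠ 2) (f : F → ℝ) :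
    ∑ n, ∑ d, f (n + d) * f (n - d) = (∑ x, f x) ^ 2 := by
  rw [sq, sum_mul_sum, ← Fintype.sum_prod_type', ← Fintype.sum_prod_type']
  exact Fintype.sum_bijective _ (bijective_add_sub h2) _ _ fun _ => rfl

variable [DecidableEq F]

/-- Characters of `F × Fˣ` along the curve `s ↦ (s² - s, 2s)`. -/
lemma norm_sum_addChar_curve_le (h2 : ringChar F ≠ 2) {c : Fˣ} (φ : AddChar (F × Additive Fˣ) ℂ)
    (hφ : φ ≠ 1) :
    ‖∑ s : Fˣ, φ ((s : F) ^ 2 - s, Additive.ofMul (c * s))‖ ≤ 2 * √(Fintype.card F) := by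
  let ψ : AddChar F ℂ := φ.compAddMonoidHom (AddMonoidHom.inl F (Additive Fˣ))
  let h : Fˣ →* ℂ :=
    { toFun := fun s => φ (0, Additive.ofMul s)
      map_one' := by rw [ofMul_one, ← Prod.zero_eq_mk, AddChar.map_zero_eq_one]
      map_mul' := fun s t => by
        rw [← AddChar.map_add_eq_mul, Prod.mk_add_mk, add_zero, ofMul_mul] }
  let χ : MulChar F ℂ := MulChar.ofUnitHom h.toHomUnits
  have hχ : ∀ s : Fˣ, χ s = φ (0, Additive.ofMul s) := fun s => by
    simp only [χ, MulChar.ofUnitHom_coe]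
    rfl
  have hsplit : ∀ n (s : Fˣ), φ (n, Additive.ofMul s) = χ s * ψ n := by
    intro n s
    rw [hχ, mul_comm]
    change _ = φ (n, 0) * _
    rw [← AddChar.map_add_eq_mul, Prod.mk_add_mk, add_zero, zero_add]
  have hsum : ∑ s : Fˣ, φ ((s : F) ^ 2 - s, Additive.ofMul (c * s))
      = χ c * mixedSum χ ψ 1 (-1) := by
    rw [mixedSum, mul_sum]
    refine Fintype.sum_of_injective Units.val Units.val_injective _ _ ?_ ?_
    · intro x hx
      have : x = 0 := by
        by_contra hx0
        exact hx ⟨Units.mk0 x hx0, rfl⟩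
      rw [this, χ.map_zero, zero_mul, mul_zero]
    · intro s
      rw [hsplit, Units.val_mul, map_mul, mul_assoc]
      ring_nf
  rw [hsum, norm_mul]
  refine (mul_le_of_le_one_left (norm_nonneg _) (norm_mulChar_le_one χ _)).trans ?_
  by_cases hψ : ψ = 1
  · have hχ1 : χ ≠ 1 := by
      intro hχ1
      apply hφ
      ext ⟨n, s⟩
      have := hsplit n s.toMul
      rw [ofMul_toMul] at this
      rw [this, hψ, hχ1]
      simp
    rw [mixedSum, hψ]
    simp [MulChar.sum_eq_zero_of_ne_one hχ1]
  · exact norm_mixedSum_le h2 hψ χ one_ne_zero (-1)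

lemma sum_eq_add_sum_units {g : F → ℝ} : ∑ x, g x = g 0 + ∑ s : Fˣ, g s := by
  rw [← add_sum_erase univ g (mem_univ 0)]
  congr 1
  symm
  refine sum_nbij Units.val (fun s _ => by simp) Units.val_injective.injOn (fun x hx => ?_)
    fun _ _ => rfl
  exact ⟨Units.mk0 x (by simpa using hx), by simp⟩

lemma sum_units_le {g : F → ℝ} (hg : 0 ≤ g 0) : ∑ s : Fˣ, g s ≤ ∑ x, g x := by
  rw [sum_eq_add_sum_units (g := g)]
  exact le_add_of_nonneg_left hg

lemma sum_units_correlation_le (h2 : ringChar F ≠ 2) {f : F → ℝ} (hf : ∀ x, f x = 0 ∨ f x = 1) :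
    ∑ s : Fˣ, ∑ d : Fˣ, ∑ x, f (x + s + d) * f (x + s - d) *
        (f (x + s ^ 2 + d ^ 2 + 2 * s * d) * f (x + s ^ 2 + d ^ 2 - 2 * s * d))
      ≤ (∑ x, f x) ^ 4 / Fintype.card F + 2 * √(Fintype.card F) * (∑ x, f x) ^ 2 := by
  have hf0 : ∀ x, 0 ≤ f x := fun x => by rcases hf x with h | h <;> simp [h]
  have hsq : ∀ x, f x ^ 2 = f x := fun x => by rcases hf x with h | h <;> simp [h]
  let U : F × Additive Fˣ → ℝ := fun g => f (g.1 + g.2.toMul) * f (g.1 - g.2.toMul)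
  let V : F × Additive Fˣ → ℝ := fun g => U (g.1 - (g.2.toMul : F) ^ 2, g.2)
  have hU0 : ∀ g, 0 ≤ U g := fun g => mul_nonneg (hf0 _) (hf0 _)
  have hUsq : ∀ g, U g ^ 2 = U g := fun g => by simp only [U, mul_pow, hsq]
  have hVsq : ∀ g, V g ^ 2 = V g := fun g => hUsq _
  have hU : ∑ g, U g ≤ (∑ x, f x) ^ 2 := by
    rw [Fintype.sum_prod_type, ← sum_add_mul_sub h2]
    refine sum_le_sum fun n _ => ?_
    rw [← Fintype.sum_equiv Additive.ofMul (fun d : Fˣ => f (n + d) * f (n - d)) _ fun _ => rfl]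
    exact
      sum_units_le (g := fun d => f (n + d) * f (n - d)) (mul_nonneg (hf0 _) (hf0 _))
  have hVU : ∑ g, V g = ∑ g, U g := by
    rw [Fintype.sum_prod_type_right, Fintype.sum_prod_type_right]
    exact sum_congr rfl fun d _ =>
      Fintype.sum_equiv (Equiv.subRight ((d.toMul : F) ^ 2)) _ _ fun n => rfl
  have hUn : 0 ≤ ∑ g, U g := sum_nonneg fun g _ => hU0 g
  have h20 : (2 : F) ≠ 0 := Ring.two_ne_zero h2
  have hmain := abs_sum_translate_sub_le (by positivity)
    (fun φ hφ => norm_sum_addChar_curve_le h2 (c := Units.mk0 2 h20) φ hφ) U V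
  simp only [hUsq, hVsq] at hmain
  rw [hVU, Real.mul_self_sqrt hUn] at hmain
  have hcard : (Fintype.card Fˣ : ℝ) * ((∑ g, U g) * ∑ g, U g)
      / Fintype.card (F × Additive Fˣ) = (∑ g, U g) ^ 2 / Fintype.card F := by
    rw [Fintype.card_prod, Fintype.card_congr (Additive.toMul (α := Fˣ)), Nat.cast_mul, sq,
      mul_comm (Fintype.card F : ℝ), mul_div_mul_left]
    exact_mod_cast Fintype.card_ne_zero
  rw [hcard] at hmain
  have hW : ∑ s : Fˣ, ∑ d : Fˣ, ∑ x, f (x + s + d) * f (x + s - d) *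
        (f (x + s ^ 2 + d ^ 2 + 2 * s * d) * f (x + s ^ 2 + d ^ 2 - 2 * s * d))
      = ∑ g, ∑ s : Fˣ, V g * U (g + ((s : F) ^ 2 - s, Additive.ofMul (Units.mk0 2 h20 * s))) := by
    rw [sum_comm (s := univ) (t := univ) (f := fun g (s : Fˣ) => V g * U _)]
    refine sum_congr rfl fun s _ => ?_
    rw [Fintype.sum_prod_type_right]
    refine Fintype.sum_equiv Additive.ofMul _ _ fun d => ?_
    refine Fintype.sum_equiv (Equiv.addRight ((s : F) + d ^ 2)) _ _ fun x => ?_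
    simp only [U, V, Equiv.coe_addRight, toMul_ofMul, Prod.mk_add_mk, toMul_add, Units.val_mul,
      Units.val_mk0]
    ring_nf
  rw [hW]
  have h3 := (abs_le.mp hmain).2
  have h4 : (∑ g, U g) ^ 2 / Fintype.card F ≤ (∑ x, f x) ^ 4 / Fintype.card F := by
    rw [show (∑ x, f x) ^ 4 = ((∑ x, f x) ^ 2) ^ 2 by ring]
    gcongr
  have h5 := mul_le_mul_of_nonneg_left hU
    (by positivity : 0 ≤ 2 * √(Fintype.card F : ℝ))
  linarith

lemma sum_pairCount_sq_le (h2 : ringChar F ≠ 2) {f : F → ℝ} (hf : ∀ x, f x = 0 ∨ f x = 1) :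
    ∑ x, pairCount f x ^ 2 ≤ (∑ x, f x) ^ 4 / Fintype.card F
      + 2 * √(Fintype.card F) * (∑ x, f x) ^ 2 + (∑ x, f x) ^ 2 + ∑ x, pairCount f x := by
  have hf0 : ∀ x, 0 ≤ f x := fun x => by rcases hf x with h | h <;> simp [h]
  have hf1 : ∀ x, f x ≤ 1 := fun x => by rcases hf x with h | h <;> simp [h]
  have hsq : ∀ x, f x * f x = f x := fun x => by rcases hf x with h | h <;> simp [h]
  let E : F → F → ℝ := fun s d => ∑ x, f (x + s + d) * f (x + s - d) *
        (f (x + s ^ 2 + d ^ 2 + 2 * s * d) * f (x + s ^ 2 + d ^ 2 - 2 * s * d))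
  have hexp : ∑ x, pairCount f x ^ 2 = ∑ s, ∑ d, E s d := by
    have h1 : ∀ x, pairCount f x ^ 2 = ∑ s, ∑ d, f (x + s + d) * f (x + s - d) *
        (f (x + s ^ 2 + d ^ 2 + 2 * s * d) * f (x + s ^ 2 + d ^ 2 - 2 * s * d)) := by
      intro x
      rw [sq, pairCount, sum_mul_sum, ← Fintype.sum_prod_type', ← Fintype.sum_prod_type']
      refine (Fintype.sum_bijective _ (bijective_add_sub h2) _ _ fun y => ?_).symm
      simp only
      ring_nf
    simp only [h1, E]
    rw [sum_comm]
    exact sum_congr rfl fun s _ => sum_comm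
  have hd : ∑ s, E s 0 = ∑ x, pairCount f x := by
    simp only [E, pairCount]
    rw [sum_comm]
    simp [hsq]
  have hs : ∑ d : Fˣ, E 0 d ≤ (∑ x, f x) ^ 2 := by
    have hE0 : ∀ d, E 0 d ≤ ∑ x, f (x + d) * f (x - d) := by
      intro d
      refine sum_le_sum fun x _ => ?_
      simp only [add_zero]
      exact mul_le_of_le_one_right (mul_nonneg (hf0 _) (hf0 _))
        (mul_le_one₀ (hf1 _) (hf0 _) (hf1 _))
    calc ∑ d : Fˣ, E 0 d ≤ ∑ d : Fˣ, ∑ x, f (x + d) * f (x - d) :=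
          sum_le_sum fun d _ => hE0 d
      _ ≤ ∑ d, ∑ x, f (x + d) * f (x - d) :=
          sum_units_le (g := fun d => ∑ x, f (x + d) * f (x - d))
            (sum_nonneg fun x _ => mul_nonneg (hf0 _) (hf0 _))
      _ = _ := by rw [sum_comm, sum_add_mul_sub h2]
  have hsplit : ∑ s, ∑ d, E s d = ∑ s, E s 0 + (∑ d : Fˣ, E 0 d + ∑ s : Fˣ, ∑ d : Fˣ, E s d) := by
    rw [← sum_eq_add_sum_units (g := fun s => ∑ d : Fˣ, E s d), ← sum_add_distrib]
    exact sum_congr rfl fun s _ => sum_eq_add_sum_units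
  have hW : ∑ s : Fˣ, ∑ d : Fˣ, E s d ≤ _ := sum_units_correlation_le h2 hf
  rw [hexp, hsplit, hd]
  linarith

/-- A variance bound for `pairCount`. -/
lemma sum_pairCount_sub_sq_le (h2 : ringChar F ≠ 2) {f : F → ℝ} (hf : ∀ x, f x = 0 ∨ f x = 1)
    (ha : 1 ≤ ∑ x, f x) :
    ∑ x, (pairCount f x - (∑ x, f x) ^ 2 / Fintype.card F) ^ 2
      ≤ 7 * √(Fintype.card F) * (∑ x, f x) ^ 2 := by
  have hf1 : ∀ x, f x ≤ 1 := fun x => by rcases hf x with h | h <;> simp [h]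
  have haq : ∑ x, f x ≤ Fintype.card F := by
    simpa using sum_le_sum fun x (_ : x ∈ univ) => hf1 x
  obtain ⟨hM1, hM2⟩ := abs_le.mp (abs_sum_pairCount_sub_le h2 hf)
  have hM := sum_pairCount_sq_le h2 hf
  set a := ∑ x, f x
  set R := √(Fintype.card F : ℝ) with hR
  have hq0 : (0 : ℝ) ≤ Fintype.card F := Nat.cast_nonneg _
  have hq1 : (1 : ℝ) ≤ Fintype.card F := ha.trans haq
  have hRR : (Fintype.card F : ℝ) = R * R := (Real.mul_self_sqrt hq0).symm
  have hR1 : 1 ≤ R := Real.one_le_sqrt.mpr hq1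
  have hexp : ∑ x, (pairCount f x - a ^ 2 / Fintype.card F) ^ 2
      = ∑ x, pairCount f x ^ 2 - 2 * (a ^ 2 / Fintype.card F) * ∑ x, pairCount f x
        + a ^ 4 / Fintype.card F := by
    simp only [sub_sq, sum_add_distrib, sum_sub_distrib, sum_const, card_univ, nsmul_eq_mul]
    rw [← sum_mul, ← mul_sum]
    field_simp
  rw [hexp]
  have h1 : 2 * (a ^ 2 / Fintype.card F) * (a ^ 2 - R * a)
      ≤ 2 * (a ^ 2 / Fintype.card F) * ∑ x, pairCount f x := by
    gcongr
    linarith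
  have h3 : 2 * (a ^ 2 / Fintype.card F) * (a ^ 2 - R * a)
      = 2 * (a ^ 4 / Fintype.card F) - 2 * R * a ^ 2 * (a / Fintype.card F) := by
    field_simp
  have h4 : 2 * R * a ^ 2 * (a / Fintype.card F) ≤ 2 * R * a ^ 2 :=
    mul_le_of_le_one_right (by positivity) (div_le_one_of_le₀ haq hq0)
  have h5 : R * a ≤ R * a ^ 2 := by nlinarith
  have h6 : a ^ 2 ≤ R * a ^ 2 := by nlinarith [sq_nonneg a]
  linarith

lemma exists_quadratic_progression (h2 : ringChar F ≠ 2) (A : Finset F)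
    (hA : 4 * (Fintype.card F : ℝ) ^ ((5 : ℝ) / 6) ≤ (#A : ℝ)) :
    ∃ x y : F, y ≠ 0 ∧ x ∈ A ∧ x + y ∈ A ∧ x + y ^ 2 ∈ A := by
  by_contra! hno
  let f : F → ℝ := fun x => if x ∈ A then 1 else 0
  have hf : ∀ x, f x = 0 ∨ f x = 1 := fun x => by by_cases h : x ∈ A <;> simp [f, h]
  have hcardA : ∑ x, f x = #A := by simp [f]
  obtain ⟨t, ht1, htq⟩ : ∃ t : ℝ, 1 ≤ t ∧ (Fintype.card F : ℝ) = t ^ 6 := by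
    have hq1 : (1 : ℝ) ≤ Fintype.card F := by exact_mod_cast Fintype.card_pos
    refine ⟨(Fintype.card F : ℝ) ^ ((1 : ℝ) / 6), Real.one_le_rpow hq1 (by norm_num), ?_⟩
    rw [← Real.rpow_natCast, ← Real.rpow_mul (by positivity)]
    norm_num
  have ht0 : 0 ≤ t := by linarith
  have hroot : √(Fintype.card F : ℝ) = t ^ 3 := by
    rw [htq, show t ^ 6 = (t ^ 3) ^ 2 by ring, Real.sqrt_sq (by positivity)]
  have hpow : (Fintype.card F : ℝ) ^ ((5 : ℝ) / 6) = t ^ 5 := by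
    rw [htq, ← Real.rpow_natCast, ← Real.rpow_natCast, ← Real.rpow_mul ht0]
    norm_num
  rw [hpow] at hA
  have ht5 : 1 ≤ t ^ 5 := one_le_pow₀ ht1
  have hvar := sum_pairCount_sub_sq_le h2 hf (by rw [hcardA]; linarith)
  rw [hroot, htq, hcardA] at hvar
  have hone : ∀ x ∈ A, pairCount f x = 1 := by
    intro x hx
    rw [pairCount, sum_eq_single_of_mem 0 (mem_univ 0)]
    · simp only [f, add_zero, zero_pow two_ne_zero, if_pos hx, mul_one]
    · intro y _ hy
      by_cases hxy : x + y ∈ A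
      · simp only [f, if_neg (hno x y hy hx hxy), mul_zero]
      · simp [f, hxy]
  set a : ℝ := (#A : ℝ) with ha
  have hlow : a * (1 - a ^ 2 / t ^ 6) ^ 2 ≤ 7 * t ^ 3 * a ^ 2 := by
    refine le_trans ?_ hvar
    calc a * (1 - a ^ 2 / t ^ 6) ^ 2 = ∑ x ∈ A, (pairCount f x - a ^ 2 / t ^ 6) ^ 2 := by
          rw [sum_congr rfl fun x hx => by rw [hone x hx], sum_const, nsmul_eq_mul]
      _ ≤ _ := sum_le_sum_of_subset_of_nonneg (subset_univ _) fun _ _ _ => sq_nonneg _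
  set μ := a ^ 2 / t ^ 6 with hμ
  have haμ : a ^ 2 = μ * t ^ 6 := by rw [hμ]; field_simp
  have ha0 : 0 < a := by linarith
  have hμ2 : 2 ≤ μ := by
    rw [hμ, le_div_iff₀ (by positivity)]
    have h1 : (4 * t ^ 5) ^ 2 ≤ a ^ 2 := pow_le_pow_left₀ (by positivity) hA 2
    have h3 : t ^ 6 ≤ t ^ 10 := pow_le_pow_right₀ ht1 (by norm_num)
    nlinarith [pow_nonneg ht0 6]
  have hμsq : μ ^ 2 ≤ 28 * t ^ 3 * a := by
    have h1 : a * (μ ^ 2 / 4) ≤ a * (7 * t ^ 3 * a) := by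
      calc a * (μ ^ 2 / 4) ≤ a * (1 - μ) ^ 2 :=
            mul_le_mul_of_nonneg_left (by nlinarith) ha0.le
        _ ≤ 7 * t ^ 3 * a ^ 2 := hlow
        _ = _ := by ring
    linarith [le_of_mul_le_mul_left h1 ha0]
  have hcube : a ^ 3 ≤ 28 * t ^ 15 := by
    have h1 : a * a ^ 3 ≤ a * (28 * t ^ 15) := by
      calc a * a ^ 3 = (a ^ 2) ^ 2 := by ring
        _ = μ ^ 2 * t ^ 12 := by rw [haμ]; ring
        _ ≤ 28 * t ^ 3 * a * t ^ 12 := by gcongr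
        _ = _ := by ring
    exact le_of_mul_le_mul_left h1 ha0
  have h64 : (4 * t ^ 5) ^ 3 ≤ a ^ 3 := pow_le_pow_left₀ (by positivity) hA 3
  have : 0 < t ^ 15 := by positivity
  nlinarith

end Progressions

/-- Any subset `A` of a finite field `F` of odd characteristic with
`|A| ≥ C·q^{5/6}` (for an absolute constant `C`) contains a nontrivial quadratic
progression `(x, x+y, x+y²)` with `y ≠ 0`. -/
theorem statement0 :
    ∃ C : ℝ, 0 < C ∧
      ∀ (F : Type) [Field F] [Fintype F], ringChar F ≠ 2 →
        ∀ A : Finset F,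
          C * (Fintype.card F : ℝ) ^ ((5 : ℝ) / 6) ≤ (A.card : ℝ) →
          ∃ x y : F, y ≠ 0 ∧ x ∈ A ∧ x + y ∈ A ∧ x + y ^ 2 ∈ A := by
  classical exact ⟨4, by norm_num, fun F _ _ h2 A hA => exists_quadratic_progression h2 A hA⟩
end

section
/- Let F = F_q be a finite field of odd order q and let K be a field extension of F of degree 3. Call a two-dimensional F-linear subspace V ⊆ K bad if 1 ∉ V and there exists a nonzero y ∈ V with y² ∈ V. Then the number of bad subspaces is at most q(q+1)/2, while the number of two-dimensional F-linear subspaces V ⊆ K with 1 ∉ V equals q². In particular, there exists a two-dimensional F-linear subspace V ⊆ K with 1 ∉ V that is not bad. -/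
section

open Module

variable {F K : Type*} [Field F] [Field K] [Algebra F K]

theorem Submodule.notMem_range_algebraMap_of_one_notMem {V : Submodule F K} (h1 : (1 : K) ∉ V)
    {y : K} (hy : y ∈ V) (hy0 : y ≠ 0) : y ∉ Set.range (algebraMap F K) := by
  rintro ⟨c, rfl⟩
  have hc : c ≠ 0 := by
    rintro rfl
    exact hy0 (map_zero _)
  apply h1
  have := V.smul_mem c⁻¹ hy
  rwa [Algebra.smul_def, ← map_mul, inv_mul_cancel₀ hc, map_one] at this

theorem linearIndependent_pair_self_sq {y : K} (hy : y ∉ Set.range (algebraMap F K)) :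
    LinearIndependent F ![y, y ^ 2] := by
  have hy0 : y ≠ 0 := by
    rintro rfl
    exact hy ⟨0, map_zero _⟩
  rw [LinearIndependent.pair_iff]
  intro s t h
  have h' : algebraMap F K s + algebraMap F K t * y = 0 := by
    apply mul_left_cancel₀ hy0
    rw [Algebra.smul_def, Algebra.smul_def] at h
    linear_combination h
  have ht : t = 0 := by
    by_contra ht
    have ht' : algebraMap F K t ≠ 0 := by simpa using ht
    refine hy ⟨-s / t, ?_⟩
    rw [map_div₀, map_neg, div_eq_iff ht']
    linear_combination -h'
  subst ht
  simpa using h'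

theorem Submodule.eq_span_self_sq {V : Submodule F K} (hV : finrank F V = 2) (h1 : (1 : K) ∉ V)
    {y : K} (hy : y ∈ V) (hy0 : y ≠ 0) (hy2 : y ^ 2 ∈ V) :
    V = Submodule.span F (Set.range ![y, y ^ 2]) := by
  have : FiniteDimensional F V := FiniteDimensional.of_finrank_pos (by omega)
  have hli := linearIndependent_pair_self_sq (V.notMem_range_algebraMap_of_one_notMem h1 hy hy0)
  symm
  apply Submodule.eq_of_le_of_finrank_eq
  · rw [Submodule.span_le]
    rintro _ ⟨i, rfl⟩
    fin_cases i
    · exact hy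
    · exact hy2
  · rw [finrank_span_eq_card hli, hV, Fintype.card_fin]

/-- Otherwise `V` would be stable under multiplication by `y`, which would then be onto `V`,
and the preimage of `y` is `1`. -/
theorem Submodule.pow_three_notMem {V : Submodule F K} (hV : finrank F V = 2) (h1 : (1 : K) ∉ V)
    {y : K} (hy : y ∈ V) (hy0 : y ≠ 0) (hy2 : y ^ 2 ∈ V) : y ^ 3 ∉ V := by
  intro hy3
  have : FiniteDimensional F V := FiniteDimensional.of_finrank_pos (by omega)
  have hmap : V.map (LinearMap.mulLeft F y) ≤ V := by
    conv_lhs => rw [V.eq_span_self_sq hV h1 hy hy0 hy2]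
    rw [Submodule.map_span, Submodule.span_le]
    rintro _ ⟨_, ⟨i, rfl⟩, rfl⟩
    fin_cases i
    · simpa [← sq] using hy2
    · simpa [← pow_succ'] using hy3
  have heq : V.map (LinearMap.mulLeft F y) = V :=
    Submodule.eq_of_le_of_finrank_eq hmap
      (Submodule.equivMapOfInjective _ (mul_right_injective₀ hy0) V).finrank_eq.symm
  obtain ⟨v, hv, hvy⟩ := heq.ge hy
  have : v = 1 := mul_left_cancel₀ hy0 (by simpa using hvy)
  exact h1 (this ▸ hv)

/-- The kernels of the functionals sending `1` to `1` are the planes avoiding `1`. -/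
noncomputable def planeEquivDual (hrank : finrank F K = 3) :
    {f : Dual F K // f 1 = 1} ≃ {V : Submodule F K // finrank F V = 2 ∧ (1 : K) ∉ V} := by
  have : FiniteDimensional F K := FiniteDimensional.of_finrank_pos (by omega)
  have hker (f : Dual F K) (hf : f 1 = 1) : finrank F (LinearMap.ker f) = 2 := by
    have := Dual.finrank_ker_add_one_of_ne_zero (f := f) (by rintro rfl; simp at hf)
    omega
  refine Equiv.ofBijective
    (fun f => ⟨LinearMap.ker f.1, hker f.1 f.2, by simp [LinearMap.mem_ker, f.2]⟩) ⟨?_, ?_⟩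
  · rintro ⟨f, hf⟩ ⟨g, hg⟩ h
    have h : LinearMap.ker f = LinearMap.ker g := congrArg Subtype.val h
    ext x
    have hx : x - f x • (1 : K) ∈ LinearMap.ker g := by
      rw [← h]
      simp [hf]
    have hx : g x - f x = 0 := by simpa [hg] using hx
    exact (sub_eq_zero.1 hx).symm
  · rintro ⟨V, hV, h1⟩
    obtain ⟨f, hf, hle⟩ := Submodule.exists_le_ker_of_notMem h1
    have hg : ((f 1)⁻¹ • f) 1 = 1 := by simp [hf]
    refine ⟨⟨(f 1)⁻¹ • f, hg⟩, Subtype.ext (Eq.symm ?_)⟩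
    apply Submodule.eq_of_le_of_finrank_eq
    · intro x hx
      have : f x = 0 := hle hx
      simp [this]
    · rw [hker _ hg, hV]

theorem card_planes [Fintype F] [Finite K] (hrank : finrank F K = 3) :
    Nat.card {V : Submodule F K // finrank F V = 2 ∧ (1 : K) ∉ V} = Fintype.card F ^ 2 := by
  obtain ⟨f₀, hf₀⟩ : ∃ f : Dual F K, f 1 = 1 := by
    obtain ⟨f, hf⟩ := Projective.exists_dual_ne_zero F (one_ne_zero (α := K))
    exact ⟨(f 1)⁻¹ • f, by simp [hf]⟩
  have : FiniteDimensional F K := FiniteDimensional.of_finrank_pos (by omega)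
  let ev : Dual F (Dual F K) := Dual.eval F K 1
  have hev : ev ≠ 0 := fun h => by
    have : ev f₀ = 0 := by rw [h]; rfl
    simp [ev, hf₀] at this
  have hfin := Dual.finrank_ker_add_one_of_ne_zero hev
  rw [Subspace.dual_finrank_eq, hrank] at hfin
  have e : {f : Dual F K // f 1 = 1} ≃ LinearMap.ker ev :=
    (Equiv.subRight f₀).subtypeEquiv fun f => by
      simp [ev, hf₀, sub_eq_zero]
  rw [← Nat.card_congr (planeEquivDual hrank), Nat.card_congr e,
    natCard_eq_pow_finrank (K := F), Nat.card_eq_fintype_card]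
  congr 1
  omega

/-- The quadratic form `y ↦ f (y ^ 2)` on the plane `ker f` is isotropic and nondegenerate,
so it has a second isotropic line. -/
theorem Submodule.exists_second_sq_mem (hchar : ringChar F ≠ 2) (hrank : finrank F K = 3)
    {V : Submodule F K} (hV : finrank F V = 2) (h1 : (1 : K) ∉ V)
    {y : K} (hy : y ∈ V) (hy0 : y ≠ 0) (hy2 : y ^ 2 ∈ V) :
    ∃ z ∈ V, z ^ 2 ∈ V ∧ LinearIndependent F ![y, z] := by
  obtain ⟨f, hf⟩ := (planeEquivDual hrank).surjective ⟨V, hV, h1⟩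
  have hf : LinearMap.ker f.1 = V := congrArg Subtype.val hf
  have hy3 : f.1 (y ^ 3) ≠ 0 := fun h => V.pow_three_notMem hV h1 hy hy0 hy2 (hf ▸ h)
  have h2 : (2 : F) ≠ 0 := Ring.two_ne_zero hchar
  set c : F := -f.1 (y ^ 4) / (2 * f.1 (y ^ 3)) with hc
  refine ⟨c • y + y ^ 2, V.add_mem (V.smul_mem c hy) hy2, ?_, ?_⟩
  · have hexp : (c • y + y ^ 2) ^ 2 = c ^ 2 • y ^ 2 + ((2 * c) • y ^ 3 + y ^ 4) := by
      simp only [Algebra.smul_def, map_mul, map_pow, map_ofNat]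
      ring
    rw [hexp]
    refine V.add_mem (V.smul_mem _ hy2) ?_
    rw [← hf, LinearMap.mem_ker, map_add, map_smul, smul_eq_mul, hc]
    field_simp
    ring
  · have hli := linearIndependent_pair_self_sq (V.notMem_range_algebraMap_of_one_notMem h1 hy hy0)
    rw [LinearIndependent.pair_iff] at hli ⊢
    intro s t h
    obtain ⟨hs, ht⟩ := hli (s + t * c) t (by rw [← h]; module)
    subst ht
    exact ⟨by simpa using hs, rfl⟩

theorem two_mul_card_bad_planes_le [Fintype F] [Finite K] (hchar : ringChar F ≠ 2)
    (hrank : finrank F K = 3) :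
    2 * Nat.card {V : Submodule F K // finrank F V = 2 ∧ (1 : K) ∉ V ∧
        ∃ y ∈ V, y ≠ 0 ∧ y ^ 2 ∈ V} ≤ Fintype.card F * (Fintype.card F + 1) := by
  classical
  set B := {V : Submodule F K // finrank F V = 2 ∧ (1 : K) ∉ V ∧ ∃ y ∈ V, y ≠ 0 ∧ y ^ 2 ∈ V}
  have hex (V : B) : ∃ g : Fin 2 → K, (∀ i, g i ∈ V.1 ∧ g i ^ 2 ∈ V.1) ∧
      LinearIndependent F g := by
    obtain ⟨V, hV, h1, y, hy, hy0, hy2⟩ := V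
    obtain ⟨z, hz, hz2, hli⟩ := V.exists_second_sq_mem hchar hrank hV h1 hy hy0 hy2
    refine ⟨![y, z], fun i => ?_, hli⟩
    fin_cases i
    · exact ⟨hy, hy2⟩
    · exact ⟨hz, hz2⟩
  choose g hg hli using hex
  have hmem (p : B × Fin 2 × Fˣ) : p.2.2 • g p.1 p.2.1 ∈ p.1.1 ∧ p.2.2 • g p.1 p.2.1 ≠ 0 ∧
      (p.2.2 • g p.1 p.2.1) ^ 2 ∈ p.1.1 := by
    refine ⟨p.1.1.smul_mem (p.2.2 : F) (hg _ _).1, ?_, ?_⟩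
    · rw [Ne, smul_eq_zero_iff_eq]
      exact (hli p.1).ne_zero _
    · rw [Units.smul_def, smul_pow]
      exact p.1.1.smul_mem _ (hg _ _).2
  let φ : B × Fin 2 × Fˣ → {y : K // y ∉ Set.range (algebraMap F K)} := fun p =>
    ⟨p.2.2 • g p.1 p.2.1,
      p.1.1.notMem_range_algebraMap_of_one_notMem p.1.2.2.1 (hmem p).1 (hmem p).2.1⟩
  have hφ : Function.Injective φ := by
    intro p p' h
    have hw : p.2.2 • g p.1 p.2.1 = p'.2.2 • g p'.1 p'.2.1 := congrArg Subtype.val h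
    have hVV : p.1 = p'.1 := by
      apply Subtype.ext
      rw [p.1.1.eq_span_self_sq p.1.2.1 p.1.2.2.1 (hmem p).1 (hmem p).2.1 (hmem p).2.2,
        p'.1.1.eq_span_self_sq p'.1.2.1 p'.1.2.2.1 (hmem p').1 (hmem p').2.1 (hmem p').2.2, hw]
    obtain ⟨V, i, c⟩ := p
    obtain ⟨V', j, d⟩ := p'
    obtain rfl : V = V' := hVV
    have hsingle : Finsupp.single i (c : F) = Finsupp.single j (d : F) := by
      apply hli V
      simpa [Finsupp.linearCombination_single, Units.smul_def] using hw
    rcases (Finsupp.single_eq_single_iff _ _ _ _).1 hsingle with ⟨rfl, hcd⟩ | ⟨hc, -⟩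
    · rw [Units.ext hcd]
    · exact absurd hc c.ne_zero
  have hle := Nat.card_le_card_of_injective φ hφ
  have hcompl : Nat.card {y : K // y ∉ Set.range (algebraMap F K)} + Fintype.card F =
      Fintype.card F ^ 3 := by
    have hK : Nat.card K = Fintype.card F ^ 3 := by
      rw [natCard_eq_pow_finrank (K := F), hrank, Nat.card_eq_fintype_card]
    have hr : (Set.range (algebraMap F K)).ncard = Fintype.card F := by
      rw [← Set.image_univ, Set.ncard_image_of_injective _ (algebraMap F K).injective,
        Set.ncard_univ, Nat.card_eq_fintype_card]
    have := Set.ncard_add_ncard_compl (Set.range (algebraMap F K))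
    rw [hr, hK, add_comm] at this
    exact this
  rw [Nat.card_prod, Nat.card_prod, Nat.card_units, Nat.card_fin,
    Nat.card_eq_fintype_card (α := F)] at hle
  obtain ⟨m, hm⟩ : ∃ m, Fintype.card F = m + 2 :=
    Nat.exists_eq_add_of_le' Fintype.one_lt_card
  rw [hm] at hle hcompl ⊢
  rw [show m + 2 - 1 = m + 1 by omega] at hle
  refine Nat.le_of_mul_le_mul_right ?_ (Nat.succ_pos m)
  rw [Nat.succ_eq_add_one]
  linarith

end

/-- in a cubic extension `K/F` of finite fields of odd order `q`,
the number of "bad" planes (two-dimensional `F`-subspaces `V` with `1 ∉ V`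
containing some nonzero `y` with `y² ∈ V`) is at most `q(q+1)/2`, the number of
planes with `1 ∉ V` equals `q²`, and hence some plane with `1 ∉ V` is not bad. -/
theorem statement15 (F K : Type) [Field F] [Fintype F] [Field K] [Fintype K]
    [Algebra F K] (hchar : ringChar F ≠ 2) (hrank : Module.finrank F K = 3) :
    Nat.card {V : Submodule F K // Module.finrank F V = 2 ∧ (1 : K) ∉ V ∧
        ∃ y ∈ V, y ≠ 0 ∧ y ^ 2 ∈ V} ≤
      Fintype.card F * (Fintype.card F + 1) / 2 ∧
    Nat.card {V : Submodule F K // Module.finrank F V = 2 ∧ (1 : K) ∉ V} =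
      Fintype.card F ^ 2 ∧
    ∃ V : Submodule F K, Module.finrank F V = 2 ∧ (1 : K) ∉ V ∧
      ∀ y ∈ V, y ^ 2 ∈ V → y = 0 := by
  have hbad := two_mul_card_bad_planes_le hchar hrank
  have hall := card_planes hrank
  refine ⟨by omega, hall, ?_⟩
  by_contra! hno
  have heq : Nat.card {V : Submodule F K // Module.finrank F V = 2 ∧ (1 : K) ∉ V} =
      Nat.card {V : Submodule F K // Module.finrank F V = 2 ∧ (1 : K) ∉ V ∧
        ∃ y ∈ V, y ≠ 0 ∧ y ^ 2 ∈ V} := by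
    refine Nat.card_congr (Equiv.subtypeEquivRight fun V => ⟨fun ⟨hV, h1⟩ => ?_, fun h =>
      ⟨h.1, h.2.1⟩⟩)
    obtain ⟨y, hy, hy2, hy0⟩ := hno V hV h1
    exact ⟨hV, h1, y, hy, hy0, hy2⟩
  have hq : 1 < Fintype.card F := Fintype.one_lt_card
  rw [← heq, hall] at hbad
  nlinarith
end
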